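/- arXiv:2604.20138 — 6 statements merged into one kernel-verified Lean document; each statement's English description precedes it below -/
import Mathlib

section
/- König's theorem: For every finite bipartite graph G, the maximum cardinality ν(G) of a matching equals the minimum cardinality τ(G) of a vertex cover. -/
/-- `M` is a matching of the bipartite graph with parts `L`, `R` and edge set `E ⊆ L × R`:
a subset of `E` in which no two edges share a vertex in `L` or a vertex in `R`. -/
def IsMatching {L R : Type*} (E M : Finset (L × R)) : Prop :=
  M ⊆ E ∧ (∀ e ∈ M, ∀ e' ∈ M, e.1 = e'.1 → e = e') ∧
    (∀ e ∈ M, ∀ e' ∈ M, e.2 = e'.2 → e = e')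

/-- `ν(G)`: the maximum cardinality of a matching of the bipartite graph with edge set `E`. -/
noncomputable def matchNum {L R : Type*} (E : Finset (L × R)) : ℕ :=
  sSup {k : ℕ | ∃ M : Finset (L × R), IsMatching E M ∧ M.card = k}

/-- `(CL, CR)` is a vertex cover: every edge of `E` has its left endpoint in `CL`
or its right endpoint in `CR`. -/
def IsCover {L R : Type*} (E : Finset (L × R)) (CL : Finset L) (CR : Finset R) : Prop :=
  ∀ e ∈ E, e.1 ∈ CL ∨ e.2 ∈ CR

/-- `τ(G)`: the minimum cardinality `|CL| + |CR|` of a vertex cover. -/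
noncomputable def coverNum {L R : Type*} (E : Finset (L × R)) : ℕ :=
  sInf {k : ℕ | ∃ (CL : Finset L) (CR : Finset R), IsCover E CL CR ∧ CL.card + CR.card = k}

/-- In a minimum vertex cover `(A, B)` of a relation `r`, the part `A` can be matched injectively
into the complement of `B`. -/
theorem exists_injective_of_minimum_cover {α β : Type*} [Fintype β] (r : α → β → Prop)
    (A : Finset α) (B : Finset β) (hcov : ∀ a b, r a b → a ∈ A ∨ b ∈ B)
    (hmin : ∀ (A' : Finset α) (B' : Finset β), (∀ a b, r a b → a ∈ A' ∨ b ∈ B') →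
      A.card + B.card ≤ A'.card + B'.card) :
    ∃ f : A → β, Function.Injective f ∧ ∀ a : A, r a (f a) ∧ f a ∉ B := by
  classical
  let t : A → Finset β := fun a => {b | r a b ∧ b ∉ B}
  have hall : ∀ s : Finset A, s.card ≤ (s.biUnion t).card := by
    intro s
    have hs : s.map (Function.Embedding.subtype _) ⊆ A := by
      intro a ha
      obtain ⟨x, -, rfl⟩ := Finset.mem_map.1 ha
      exact x.2
    have h := hmin (A \ s.map (Function.Embedding.subtype _)) (B ∪ s.biUnion t) (by
      intro a b hab
      by_cases hb : b ∈ B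
      · exact Or.inr (Finset.mem_union_left _ hb)
      have ha : a ∈ A := (hcov a b hab).resolve_right hb
      by_cases has : (⟨a, ha⟩ : A) ∈ s
      · refine Or.inr (Finset.mem_union_right _ (Finset.mem_biUnion.2 ⟨_, has, ?_⟩))
        simp [t, hab, hb]
      · left
        simp [ha, has])
    have h₁ := Finset.card_sdiff_add_card_eq_card hs
    have h₂ := Finset.card_union_le B (s.biUnion t)
    rw [Finset.card_map] at h₁
    omega
  obtain ⟨f, hf, hft⟩ := (Finset.all_card_le_biUnion_card_iff_exists_injective t).1 hall
  exact ⟨f, hf, fun a => by simpa [t] using hft a⟩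

/-- Weak duality: a matching is no larger than a vertex cover. -/
theorem IsMatching.card_le_of_isCover {L R : Type*} {E M : Finset (L × R)} {CL : Finset L}
    {CR : Finset R} (hM : IsMatching E M) (hC : IsCover E CL CR) :
    M.card ≤ CL.card + CR.card := by
  classical
  have hsub : M ⊆ M.filter (fun e => e.1 ∈ CL) ∪ M.filter (fun e => e.2 ∈ CR) := by
    intro e he
    have := hC e (hM.1 he)
    simpa [he] using this
  have h₁ : (M.filter (fun e => e.1 ∈ CL)).card ≤ CL.card :=
    Finset.card_le_card_of_injOn Prod.fst (fun e he => (Finset.mem_filter.1 he).2)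
      fun e he e' he' h =>
        hM.2.1 e (Finset.mem_filter.1 he).1 e' (Finset.mem_filter.1 he').1 h
  have h₂ : (M.filter (fun e => e.2 ∈ CR)).card ≤ CR.card :=
    Finset.card_le_card_of_injOn Prod.snd (fun e he => (Finset.mem_filter.1 he).2)
      fun e he e' he' h =>
        hM.2.2 e (Finset.mem_filter.1 he).1 e' (Finset.mem_filter.1 he').1 h
  have h₃ := Finset.card_le_card hsub
  have h₄ := Finset.card_union_le (M.filter (fun e => e.1 ∈ CL)) (M.filter (fun e => e.2 ∈ CR))
  omega

/-- A minimum vertex cover `(CL, CR)` admits a matching of the same size. -/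
theorem exists_isMatching_card_eq_of_minimum_cover {L R : Type*} [Fintype L] [Fintype R]
    {E : Finset (L × R)} {CL : Finset L} {CR : Finset R} (hC : IsCover E CL CR)
    (hmin : ∀ CL' CR', IsCover E CL' CR' → CL.card + CR.card ≤ CL'.card + CR'.card) :
    ∃ M, IsMatching E M ∧ M.card = CL.card + CR.card := by
  classical
  obtain ⟨f, hf, hfE⟩ := exists_injective_of_minimum_cover (fun l r => (l, r) ∈ E) CL CR
    (fun l r h => hC (l, r) h) (fun A B h => hmin A B fun e he => h e.1 e.2 he)
  obtain ⟨g, hg, hgE⟩ := exists_injective_of_minimum_cover (fun r l => (l, r) ∈ E) CR CL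
    (fun r l h => (hC (l, r) h).symm) (fun B A h => by
      have := hmin A B fun e he => (h e.2 e.1 he).symm
      omega)
  let φ : CL ⊕ CR → L × R := Sum.elim (fun l => (l.1, f l)) (fun r => (g r, r.1))
  have hfst : Function.Injective (fun x => (φ x).1) := by
    rintro (x | x) (y | y) h <;> simp only [φ, Sum.elim_inl, Sum.elim_inr] at h
    · rw [Subtype.ext h]
    · exact absurd (h ▸ x.2) (hgE y).2
    · exact absurd (h ▸ y.2) (hgE x).2
    · rw [hg h]
  have hsnd : Function.Injective (fun x => (φ x).2) := by
    rintro (x | x) (y | y) h <;> simp only [φ, Sum.elim_inl, Sum.elim_inr] at h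
    · rw [hf h]
    · exact absurd (h ▸ y.2) (hfE x).2
    · exact absurd (h ▸ x.2) (hfE y).2
    · rw [Subtype.ext h]
  refine ⟨Finset.univ.image φ, ⟨?_, ?_, ?_⟩, ?_⟩
  · intro e he
    obtain ⟨x | x, -, rfl⟩ := Finset.mem_image.1 he
    · exact (hfE x).1
    · exact (hgE x).1
  · intro e he e' he' h
    obtain ⟨x, -, rfl⟩ := Finset.mem_image.1 he
    obtain ⟨y, -, rfl⟩ := Finset.mem_image.1 he'
    rw [hfst h]
  · intro e he e' he' h
    obtain ⟨x, -, rfl⟩ := Finset.mem_image.1 he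
    obtain ⟨y, -, rfl⟩ := Finset.mem_image.1 he'
    rw [hsnd h]
  · rw [Finset.card_image_of_injective _ (Function.Injective.of_comp (f := Prod.fst) hfst)]
    simp

/-- König's theorem: for every finite bipartite graph, the maximum cardinality of a
matching equals the minimum cardinality of a vertex cover. -/
theorem konig {L R : Type*} [Fintype L] [Fintype R] (E : Finset (L × R)) :
    matchNum E = coverNum E := by
  have hne : {k : ℕ | ∃ (CL : Finset L) (CR : Finset R),
      IsCover E CL CR ∧ CL.card + CR.card = k}.Nonempty :=
    ⟨_, Finset.univ, ∅, fun e _ => Or.inl (Finset.mem_univ e.1), rfl⟩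
  obtain ⟨CL, CR, hC, hcard⟩ := Nat.sInf_mem hne
  change _ = coverNum E at hcard
  obtain ⟨M, hM, hMcard⟩ := exists_isMatching_card_eq_of_minimum_cover hC
    fun CL' CR' h => hcard.trans_le (Nat.sInf_le ⟨CL', CR', h, rfl⟩)
  have hgreatest : IsGreatest {k : ℕ | ∃ M : Finset (L × R), IsMatching E M ∧ M.card = k}
      (coverNum E) := by
    refine ⟨⟨M, hM, hMcard.trans hcard⟩, ?_⟩
    rintro k ⟨M', hM', rfl⟩
    exact (hM'.card_le_of_isCover hC).trans_eq hcard
  exact hgreatest.csSup_eq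
end

section
/- Let F be a field, A an m × n matrix over F, and let S be a set of row indices and T a set of column indices such that every nonzero entry A i j has i ∈ S or j ∈ T (i.e., (S, T) is a vertex cover of the bipartite support graph of A). Then rank(A) ≤ |S| + |T|. -/
/-- If every nonzero entry of the matrix `A` lies in a row of `S` or a column of `T`
(i.e. `(S, T)` is a vertex cover of the bipartite support graph of `A`), then the rank
of `A` is at most `|S| + |T|`. -/
theorem rank_le_card_cover {F : Type*} [Field F] {m n : ℕ}
    (A : Matrix (Fin m) (Fin n) F) (S : Finset (Fin m)) (T : Finset (Fin n))
    (hcover : ∀ i j, A i j ≠ 0 → i ∈ S ∨ j ∈ T) :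
    A.rank ≤ S.card + T.card := by
  -- Factor `A` through the index type `S ⊕ T`.
  let P : Matrix (Fin m) (S ⊕ T) F := Matrix.of fun i =>
    Sum.elim (fun s => if i = s then 1 else 0) (fun t => if i ∈ S then 0 else A i t)
  let Q : Matrix (S ⊕ T) (Fin n) F := Matrix.of fun k j =>
    Sum.elim (fun s : S => A s j) (fun t : T => if j = t then 1 else 0) k
  have hPQ : A = P * Q := by
    ext i j
    have hS : ∑ s : S, (if i = s then A s j else 0) = if i ∈ S then A i j else 0 := by
      rw [Finset.sum_coe_sort S (fun s => if i = s then A s j else 0), Finset.sum_ite_eq]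
    have hT : ∑ t : T, (if j = t then (if i ∈ S then 0 else A i t) else 0) =
        if j ∈ T then (if i ∈ S then 0 else A i j) else 0 := by
      rw [Finset.sum_coe_sort T (fun t => if j = t then (if i ∈ S then 0 else A i t) else 0),
        Finset.sum_ite_eq]
    simp only [P, Q, Matrix.mul_apply, Fintype.sum_sum_type, Matrix.of_apply, Sum.elim_inl,
      Sum.elim_inr, ite_mul, one_mul, zero_mul, mul_ite, mul_one, mul_zero] at hS hT ⊢
    rw [hS, hT]
    grind
  calc A.rank = (P * Q).rank := by rw [← hPQ]
    _ ≤ P.rank := Matrix.rank_mul_le_left P Q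
    _ ≤ Fintype.card (S ⊕ T) := P.rank_le_card_width
    _ = S.card + T.card := by simp
end

section
/- For any m × n matrix A over a field F, the rank of A is at most the maximum cardinality of a matching of the bipartite support graph of A; that is, rank(A) ≤ ν(G) where G is the bipartite graph on rows and columns whose edges are the positions of the nonzero entries of A. -/
/-- The size of any matching is a lower bound for the matching number. -/
theorem IsMatching.card_le_matchNum {L R : Type*} {E M : Finset (L × R)} (h : IsMatching E M) :
    M.card ≤ matchNum E :=
  le_csSup ⟨E.card, by rintro _ ⟨N, hN, rfl⟩; exact Finset.card_le_card hN.1⟩ ⟨M, h, rfl⟩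

open Finset in
/-- Linearly independent rows admit a system of distinct columns in which they are nonzero. -/
theorem LinearIndependent.exists_injective_ne_zero {F κ n : Type*} [Field F] [Fintype n]
    {v : κ → n → F} (hv : LinearIndependent F v) :
    ∃ f : κ → n, Function.Injective f ∧ ∀ k, v k (f k) ≠ 0 := by
  classical
  let t : κ → Finset n := fun k => univ.filter fun j => v k j ≠ 0
  have hall : ∀ s : Finset κ, #s ≤ #(s.biUnion t) := by
    intro s
    have hs : LinearIndependent F fun k : s => v k := hv.comp _ Subtype.val_injective
    have hr := hs.rank_matrix (R := F) (M := Matrix.of fun k : s => v k)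
    rw [← Matrix.rank_transpose, Fintype.card_coe] at hr
    rw [← hr]
    apply Matrix.rank_le_card_of_support_subset
    intro j hj
    obtain ⟨k, hk⟩ := Function.ne_iff.mp hj
    exact mem_biUnion.mpr ⟨k, k.2, mem_filter.mpr ⟨mem_univ _, hk⟩⟩
  obtain ⟨f, hf, hft⟩ := (all_card_le_biUnion_card_iff_exists_injective t).mp hall
  exact ⟨f, hf, fun k => (mem_filter.mp (hft k)).2⟩

open scoped Classical in
/-- The rank of a matrix is at most the maximum cardinality of a matching of its
bipartite support graph, whose edges are the positions of the nonzero entries of `A`. -/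
theorem rank_le_matchNum_support {F : Type*} [Field F] {m n : ℕ}
    (A : Matrix (Fin m) (Fin n) F) :
    A.rank ≤ matchNum (Finset.univ.filter fun e : Fin m × Fin n => A e.1 e.2 ≠ 0) := by
  obtain ⟨κ, a, ha, hspan, hli⟩ := exists_linearIndependent' F A.row
  have : Fintype κ := Fintype.ofInjective a ha
  obtain ⟨f, hf, hne⟩ := hli.exists_injective_ne_zero
  have hinj : Function.Injective fun k => (a k, f k) := fun k l h => ha (congrArg Prod.fst h)
  have hM : IsMatching (Finset.univ.filter fun e : Fin m × Fin n => A e.1 e.2 ≠ 0)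
      (Finset.univ.image fun k => (a k, f k)) := by
    refine ⟨?_, ?_, ?_⟩
    · intro e he
      obtain ⟨k, -, rfl⟩ := Finset.mem_image.mp he
      exact Finset.mem_filter.mpr ⟨Finset.mem_univ _, hne k⟩
    · simp only [Finset.forall_mem_image]
      intro k _ l _ h
      rw [ha h]
    · simp only [Finset.forall_mem_image]
      intro k _ l _ h
      rw [hf h]
  rw [Matrix.rank_eq_finrank_span_row, ← hspan, finrank_span_eq_card hli, ← Finset.card_univ,
    ← Finset.card_image_of_injective _ hinj]
  exact hM.card_le_matchNum
end

section
/- The generic edge matrix achieves the matching bound: for every bipartite graph G with parts Fin n and Fin n and edge set E, the rank of the generic edge matrix A_G over the fraction field K equals ν(G), the maximum cardinality of a matching of G. -/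
/-- The fraction field `K` of the multivariate polynomial ring over `ℚ` with one
indeterminate `X_e` for each edge `e ∈ E`. -/
abbrev EdgeField {m n : ℕ} (E : Finset (Fin m × Fin n)) : Type :=
  FractionRing (MvPolynomial {e : Fin m × Fin n // e ∈ E} ℚ)

/-- The generic edge matrix `A_G` of the bipartite graph with edge set `E`: the `(i, j)`
entry is the indeterminate `X_{(i,j)}` if `(i, j) ∈ E`, and `0` otherwise. -/
noncomputable def genMat {m n : ℕ} (E : Finset (Fin m × Fin n)) :
    Matrix (Fin m) (Fin n) (EdgeField E) :=
  Matrix.of fun i j =>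
    if h : (i, j) ∈ E then
      algebraMap (MvPolynomial {e : Fin m × Fin n // e ∈ E} ℚ) (EdgeField E)
        (MvPolynomial.X ⟨(i, j), h⟩)
    else 0

namespace Matrix

variable {F m n : Type*} [Field F] [Fintype m] [Fintype n]

theorem exists_linearIndependent_row_submatrix (A : Matrix m n F) {k : ℕ} (hk : A.rank = k) :
    ∃ f : Fin k → m, LinearIndependent F (A.submatrix f id).row := by
  rw [rank_eq_finrank_span_row] at hk
  subst hk
  obtain ⟨v, hv, -, hli⟩ := Submodule.exists_fun_fin_finrank_span_eq F (Set.range A.row)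
  choose f hf using hv
  refine ⟨f, ?_⟩
  rwa [show (A.submatrix f id).row = v from funext hf]

/-- A matrix of rank `k` has a nonsingular `k × k` submatrix. -/
theorem exists_det_submatrix_ne_zero (A : Matrix m n F) :
    ∃ (f : Fin A.rank → m) (g : Fin A.rank → n), (A.submatrix f g).det ≠ 0 := by
  obtain ⟨f, hf⟩ := A.exists_linearIndependent_row_submatrix rfl
  obtain ⟨g, hg⟩ := (A.submatrix f id)ᵀ.exists_linearIndependent_row_submatrix
    (k := A.rank) (by rw [rank_transpose, hf.rank_matrix, Fintype.card_fin])
  refine ⟨f, g, ?_⟩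
  rw [← det_transpose]
  exact ((isUnit_iff_isUnit_det _).1 (linearIndependent_rows_iff_isUnit.1 hg)).ne_zero

/-- The entries of a matrix supported on `E` contain a matching of `E` of size the rank. -/
theorem exists_isMatching_card_eq_rank (A : Matrix m n F) {E : Finset (m × n)}
    (hA : ∀ i j, A i j ≠ 0 → (i, j) ∈ E) : ∃ M, IsMatching E M ∧ M.card = A.rank := by
  classical
  obtain ⟨f, g, hfg⟩ := A.exists_det_submatrix_ne_zero
  have hf : Function.Injective f := fun a b hab ↦ by
    by_contra hne
    exact hfg (det_zero_of_row_eq hne (by ext; simp [hab]))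
  have hg : Function.Injective g := fun a b hab ↦ by
    by_contra hne
    exact hfg (det_zero_of_column_eq hne (by simp [hab]))
  rw [det_apply] at hfg
  obtain ⟨σ, -, hσ⟩ := Finset.exists_ne_zero_of_sum_ne_zero hfg
  have hprod : ∏ i, A (f (σ i)) (g i) ≠ 0 := fun h ↦ hσ (by simp [h])
  rw [Finset.prod_ne_zero_iff] at hprod
  refine ⟨Finset.univ.image fun i ↦ (f (σ i), g i), ⟨?_, ?_, ?_⟩, ?_⟩
  · simp only [Finset.subset_iff, Finset.mem_image, Finset.mem_univ, true_and]
    rintro _ ⟨i, rfl⟩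
    exact hA _ _ (hprod i (Finset.mem_univ i))
  · simp only [Finset.mem_image, Finset.mem_univ, true_and]
    rintro _ ⟨i, rfl⟩ _ ⟨j, rfl⟩ h
    rw [σ.injective (hf h)]
  · simp only [Finset.mem_image, Finset.mem_univ, true_and]
    rintro _ ⟨i, rfl⟩ _ ⟨j, rfl⟩ h
    rw [hg h]
  · rw [Finset.card_image_of_injective _ fun i j h ↦ hg (congrArg Prod.snd h), Finset.card_univ,
      Fintype.card_fin]

end Matrix

theorem IsMatching.mk_mem_iff {L R : Type*} {E M : Finset (L × R)} (hM : IsMatching E M)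
    (e e' : M) : (e.1.1, e'.1.2) ∈ M ↔ e = e' := by
  refine ⟨fun h ↦ ?_, ?_⟩
  · exact Subtype.ext ((hM.2.1 _ e.2 _ h rfl).trans (hM.2.2 _ h _ e'.2 rfl))
  · rintro rfl
    exact e.2

theorem IsMatching.card_le_rank_genMat {m n : ℕ} {E M : Finset (Fin m × Fin n)}
    (hM : IsMatching E M) : M.card ≤ (genMat E).rank := by
  classical
  let B : Matrix M M (MvPolynomial {e : Fin m × Fin n // e ∈ E} ℚ) :=
    Matrix.of fun e e' ↦
      if h : (e.1.1, e'.1.2) ∈ E then MvPolynomial.X ⟨(e.1.1, e'.1.2), h⟩ else 0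
  let φ : MvPolynomial {e : Fin m × Fin n // e ∈ E} ℚ →+* ℚ :=
    MvPolynomial.eval fun e ↦ if e.1 ∈ M then 1 else 0
  have hφ : φ.mapMatrix B = 1 := by
    ext e e'
    by_cases h : (e.1.1, e'.1.2) ∈ E
    · simp [B, φ, h, Matrix.one_apply, hM.mk_mem_iff]
    · have hne : e ≠ e' := fun heq ↦ h (hM.1 ((hM.mk_mem_iff e e').2 heq))
      simp [B, h, hne]
  have hB : B.det ≠ 0 := fun h ↦ by
    have := φ.map_det B
    simp [hφ, h] at this
  have hsub : (genMat E).submatrix (fun e : M ↦ e.1.1) (fun e : M ↦ e.1.2) =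
      (algebraMap _ (EdgeField E)).mapMatrix B := by
    ext e e'
    by_cases h : (e.1.1, e'.1.2) ∈ E <;> simp [genMat, B, h]
  have hdet : ((genMat E).submatrix (fun e : M ↦ e.1.1) (fun e : M ↦ e.1.2)).det ≠ 0 := by
    rw [hsub, ← RingHom.map_det]
    exact (map_ne_zero_iff _ (IsFractionRing.injective _ _)).2 hB
  rw [← Fintype.card_coe M, ← Matrix.rank_of_det_ne_zero hdet]
  exact Matrix.rank_submatrix_le _ _ _

/-- The generic edge matrix achieves the matching bound: its rank over the fraction
field `K` equals `ν(G)`, the maximum cardinality of a matching of `G`. -/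
theorem rank_genMat_eq_matchNum {n : ℕ} (E : Finset (Fin n × Fin n)) :
    (genMat E).rank = matchNum E := by
  have hgreatest :
      IsGreatest {k : ℕ | ∃ M : Finset (Fin n × Fin n), IsMatching E M ∧ M.card = k}
        (genMat E).rank := by
    refine ⟨(genMat E).exists_isMatching_card_eq_rank fun i j h ↦ ?_, ?_⟩
    · by_contra hE
      exact h (by simp [genMat, hE])
    · rintro _ ⟨M, hM, rfl⟩
      exact hM.card_le_rank_genMat
  exact hgreatest.csSup_eq.symm
end

section
/- If a bipartite graph G with parts Fin n and Fin n and edge set E has a perfect matching (a matching of cardinality n), then the determinant of the generic edge matrix A_G over the fraction field K is nonzero; in particular A_G is invertible. -/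
/-- The generic edge matrix with entries in the polynomial ring itself. -/
noncomputable def polyMat {m n : ℕ} (E : Finset (Fin m × Fin n)) :
    Matrix (Fin m) (Fin n) (MvPolynomial {e : Fin m × Fin n // e ∈ E} ℚ) :=
  Matrix.of fun i j => if h : (i, j) ∈ E then MvPolynomial.X ⟨(i, j), h⟩ else 0

theorem genMat_eq_map_polyMat {m n : ℕ} (E : Finset (Fin m × Fin n)) :
    genMat E = (polyMat E).map (algebraMap _ (EdgeField E)) := by
  ext i j
  by_cases h : (i, j) ∈ E <;> simp [genMat, polyMat, h]

/-- A perfect matching is the graph of a permutation. -/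
theorem IsMatching.exists_perm {n : ℕ} {E M : Finset (Fin n × Fin n)} (hM : IsMatching E M)
    (hcard : M.card = n) : ∃ σ : Equiv.Perm (Fin n), ∀ i j, (i, j) ∈ M ↔ σ i = j := by
  obtain ⟨-, hl, hr⟩ := hM
  have himage : M.image Prod.fst = Finset.univ := by
    rw [← Finset.card_eq_iff_eq_univ, Finset.card_image_of_injOn fun e he e' he' => hl e he e' he',
      hcard, Fintype.card_fin]
  have hex : ∀ i, ∃ j, (i, j) ∈ M := fun i => by
    simpa using himage.ge (Finset.mem_univ i)
  choose f hf using hex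
  have hinj : Function.Injective f := fun i i' h => congrArg Prod.fst (hr _ (hf i) _ (hf i') h)
  refine ⟨Equiv.ofBijective f (Finite.injective_iff_bijective.mp hinj), fun i j => ⟨fun h => ?_, ?_⟩⟩
  · exact congrArg Prod.snd (hl _ (hf i) _ h rfl)
  · rintro rfl
    exact hf i

/-- Specializing the indeterminates to the indicator of a perfect matching turns the generic
edge matrix into a permutation matrix. -/
theorem det_polyMat_ne_zero {n : ℕ} {E M : Finset (Fin n × Fin n)} (hM : IsMatching E M)
    (hcard : M.card = n) : (polyMat E).det ≠ 0 := by
  obtain ⟨σ, hσ⟩ := hM.exists_perm hcard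
  let φ : MvPolynomial {e : Fin n × Fin n // e ∈ E} ℚ →+* ℚ :=
    MvPolynomial.eval fun e => if e.1 ∈ M then 1 else 0
  have hmap : φ.mapMatrix (polyMat E) = σ.permMatrix ℚ := by
    ext i j
    by_cases h : (i, j) ∈ E
    · simp [φ, polyMat, h, hσ, PEquiv.toMatrix_apply]
    · have hij : σ i ≠ j := fun hij => h (hM.1 ((hσ i j).2 hij))
      simp [polyMat, h, hij, PEquiv.toMatrix_apply]
  intro hdet
  have h := φ.map_det (polyMat E)
  rw [hdet, map_zero, hmap, Matrix.det_permutation] at h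
  exact Int.cast_ne_zero.mpr (Units.ne_zero (Equiv.Perm.sign σ)) h.symm

/-- If the bipartite graph `G` has a perfect matching (a matching of cardinality `n`),
then the determinant of the generic edge matrix is nonzero; in particular `A_G` is
invertible. -/
theorem det_genMat_ne_zero_of_perfectMatching {n : ℕ} (E : Finset (Fin n × Fin n))
    (hpm : ∃ M : Finset (Fin n × Fin n), IsMatching E M ∧ M.card = n) :
    (genMat E).det ≠ 0 ∧ IsUnit (genMat E) := by
  obtain ⟨M, hM, hcard⟩ := hpm
  have hdet : (genMat E).det ≠ 0 := by
    rw [genMat_eq_map_polyMat, ← RingHom.mapMatrix_apply, ← RingHom.map_det]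
    exact (map_ne_zero_iff _ (IsFractionRing.injective _ _)).mpr (det_polyMat_ne_zero hM hcard)
  exact ⟨hdet, (Matrix.isUnit_iff_isUnit_det _).mpr hdet.isUnit⟩
end

section
/- If a bipartite graph G with parts Fin m (rows) and Fin n (columns) and edge set E has a matching that covers every column vertex (a matching of cardinality n), then the generic edge matrix A_G, an m × n matrix over the fraction field K, has rank n; equivalently, the linear map x ↦ A_G · x is injective. -/
/-- A matching with as many edges as there are right vertices selects a left
partner for every right vertex. -/
theorem IsMatching.exists_partner {L R : Type*} [Fintype R] {E M : Finset (L × R)}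
    (hM : IsMatching E M) (hcard : M.card = Fintype.card R) :
    ∃ r : R → L, ∀ j, (r j, j) ∈ M := by
  classical
  have himage : M.image Prod.snd = Finset.univ := by
    rw [← Finset.card_eq_iff_eq_univ, Finset.card_image_of_injOn, hcard]
    exact fun e he e' he' h => hM.2.2 e he e' he' h
  have hcover : ∀ j, ∃ i, (i, j) ∈ M := by
    intro j
    have hj : j ∈ M.image Prod.snd := himage ▸ Finset.mem_univ j
    obtain ⟨⟨i, k⟩, he, rfl⟩ := Finset.mem_image.mp hj
    exact ⟨i, he⟩
  exact Classical.skolem.mp hcover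

/-- The rows of the generic edge matrix matched to the columns form a nonsingular matrix. -/
theorem det_genMat_submatrix_ne_zero {m n : ℕ} {E M : Finset (Fin m × Fin n)}
    (hM : IsMatching E M) {r : Fin n → Fin m} (hr : ∀ j, (r j, j) ∈ M) :
    ((genMat E).submatrix r id).det ≠ 0 := by
  let B : Matrix (Fin n) (Fin n) (MvPolynomial {e : Fin m × Fin n // e ∈ E} ℚ) :=
    Matrix.of fun i j => if h : (r i, j) ∈ E then MvPolynomial.X ⟨(r i, j), h⟩ else 0
  let φ := MvPolynomial.eval fun e : {e : Fin m × Fin n // e ∈ E} =>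
    if e.1 ∈ M then (1 : ℚ) else 0
  have hmap : (genMat E).submatrix r id =
      (algebraMap (MvPolynomial {e : Fin m × Fin n // e ∈ E} ℚ) (EdgeField E)).mapMatrix B := by
    ext i j
    by_cases h : (r i, j) ∈ E <;> simp [genMat, B, h]
  have hone : φ.mapMatrix B = 1 := by
    ext i j
    have hmem : (r i, j) ∈ M ↔ i = j :=
      ⟨fun h => congrArg Prod.snd (hM.2.1 _ (hr i) _ h rfl), fun h => h ▸ hr i⟩
    by_cases h : (r i, j) ∈ E
    · simp [B, φ, h, hmem, Matrix.one_apply]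
    · have hij : i ≠ j := fun hij => h (hM.1 (hmem.mpr hij))
      simp [B, h, hij]
  have hdet : B.det ≠ 0 := by
    intro h
    have hφ := φ.map_det B
    rw [hone, h, map_zero, Matrix.det_one] at hφ
    exact zero_ne_one hφ
  rw [hmap, ← RingHom.map_det]
  exact (map_ne_zero_iff _ (IsFractionRing.injective _ _)).mpr hdet

/-- If the bipartite graph `G` on parts `Fin m` (rows) and `Fin n` (columns) has a
matching covering every column vertex (a matching of cardinality `n`), then the generic
edge matrix has rank `n`; equivalently, the linear map `x ↦ A_G · x` is injective. -/
theorem rank_genMat_of_column_matching {m n : ℕ} (E : Finset (Fin m × Fin n))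
    (hm : ∃ M : Finset (Fin m × Fin n), IsMatching E M ∧ M.card = n) :
    (genMat E).rank = n ∧ Function.Injective (genMat E).mulVecLin := by
  obtain ⟨M, hM, hcard⟩ := hm
  obtain ⟨r, hr⟩ := hM.exists_partner (hcard.trans (Fintype.card_fin n).symm)
  have hinj : Function.Injective (genMat E).mulVecLin := by
    intro x y hxy
    have hunit : IsUnit ((genMat E).submatrix r id) :=
      (Matrix.isUnit_iff_isUnit_det _).mpr (det_genMat_submatrix_ne_zero hM hr).isUnit
    refine Matrix.mulVec_injective_of_isUnit hunit ?_
    ext i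
    exact congrFun hxy (r i)
  exact ⟨(LinearMap.finrank_range_of_inj hinj).trans (by simp), hinj⟩
end
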